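/- Let N ≥ 1 and z ∈ ℝ^N with z ≠ 0. Then the determinant of the Fréchet derivative of exp_0 at z equals [sinh(2|z|)/(|z|(1 + cosh(2|z|)))]^{N−1} · 2/(1 + cosh(2|z|)). In particular this determinant is strictly positive. -/

import Mathlib

/-- The exponential map at the origin of the Poincaré ball model:
`exp_0(z) = (sinh(2|z|)/((1 + cosh(2|z|)) |z|)) • z`, with `exp_0(0) = 0`. -/
noncomputable def expZero {N : ℕ} (z : EuclideanSpace ℝ (Fin N)) : EuclideanSpace ℝ (Fin N) :=
  (Real.sinh (2 * ‖z‖) / ((1 + Real.cosh (2 * ‖z‖)) * ‖z‖)) • z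

/-- The derivative at `z ≠ 0` of a radial map `x ↦ g ‖x‖ • x` on a real inner product space. -/
theorem hasFDerivAt_radial {E : Type*} [NormedAddCommGroup E] [InnerProductSpace ℝ E]
    {g : ℝ → ℝ} {g' : ℝ} {z : E} (hz : z ≠ 0) (hg : HasDerivAt g g' ‖z‖) :
    HasFDerivAt (fun x : E => g ‖x‖ • x)
      (g ‖z‖ • ContinuousLinearMap.id ℝ E +
        ((g' / ‖z‖) • innerSL ℝ z).smulRight z) z := by
  have hr : ‖z‖ ≠ 0 := norm_ne_zero_iff.mpr hz
  have hnorm : HasFDerivAt (fun x : E => ‖x‖) (‖z‖⁻¹ • innerSL ℝ z) z := by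
    have h := ((hasStrictFDerivAt_norm_sq z).hasFDerivAt).sqrt (pow_ne_zero 2 hr)
    simp only [Real.sqrt_sq (norm_nonneg _)] at h
    convert h using 1
    ext v
    simp
    field_simp
  have h := (hg.comp_hasFDerivAt z hnorm).smul (hasFDerivAt_id z)
  have heq : (g' / ‖z‖) • innerSL ℝ z = g' • ‖z‖⁻¹ • innerSL ℝ z := by
    rw [smul_smul, div_eq_mul_inv]
  rw [heq]
  exact h

/-- The determinant of the derivative at `z ≠ 0` of a radial map `x ↦ g ‖x‖ • x`. -/
theorem det_fderiv_radial {E : Type*} [NormedAddCommGroup E] [InnerProductSpace ℝ E]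
    [FiniteDimensional ℝ E] {g : ℝ → ℝ} {g' : ℝ} {z : E} (hz : z ≠ 0)
    (hg : HasDerivAt g g' ‖z‖) (hg0 : g ‖z‖ ≠ 0) :
    LinearMap.det ((fderiv ℝ (fun x : E => g ‖x‖ • x) z : E →L[ℝ] E) : E →ₗ[ℝ] E) =
      g ‖z‖ ^ (Module.finrank ℝ E - 1) * (g ‖z‖ + ‖z‖ * g') := by
  have hr : ‖z‖ ≠ 0 := norm_ne_zero_iff.mpr hz
  have : Nontrivial E := ⟨z, 0, hz⟩
  obtain ⟨n, hn⟩ := Nat.exists_eq_succ_of_ne_zero (Module.finrank_pos (R := ℝ) (M := E)).ne'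
  rw [(hasFDerivAt_radial hz hg).fderiv]
  have key : ((g ‖z‖ • ContinuousLinearMap.id ℝ E +
      ((g' / ‖z‖) • innerSL ℝ z).smulRight z : E →L[ℝ] E) : E →ₗ[ℝ] E) =
      g ‖z‖ • LinearMap.transvection
        ((g' / ‖z‖ / g ‖z‖) • (innerSL ℝ z : E →L[ℝ] ℝ).toLinearMap) z := by
    ext v
    simp only [LinearMap.smul_apply, LinearMap.transvection.apply, smul_add, smul_smul]
    simp
    congr 1
    field_simp
  rw [key, LinearMap.det_smul, LinearMap.transvection.det, hn]
  simp [pow_succ]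
  field_simp

/-- The derivative of the radial factor of `expZero`. -/
theorem hasDerivAt_sinh_div_one_add_cosh_mul {r : ℝ} (hr : r ≠ 0) :
    HasDerivAt (fun t => Real.sinh (2 * t) / ((1 + Real.cosh (2 * t)) * t))
      ((2 / (1 + Real.cosh (2 * r)) -
        Real.sinh (2 * r) / ((1 + Real.cosh (2 * r)) * r)) / r) r := by
  have hc : 1 + Real.cosh (2 * r) ≠ 0 := by positivity
  have h2 : HasDerivAt (fun t : ℝ => 2 * t) 2 r := by
    simpa using (hasDerivAt_id r).const_mul 2
  have h := h2.sinh.div ((h2.cosh.const_add 1).mul (hasDerivAt_id r)) (mul_ne_zero hc hr)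
  refine HasDerivAt.congr_deriv h ?_
  have hsq := Real.cosh_sq (2 * r)
  simp only [id, Pi.mul_apply]
  field_simp
  linear_combination 2 * r * hsq

/-- The Jacobian determinant of `exp_0` at `z ≠ 0` equals
`[sinh(2|z|)/(|z|(1 + cosh 2|z|))]^{N-1} · 2/(1 + cosh 2|z|)`, which is strictly positive. -/
theorem det_fderiv_expZero
    (N : ℕ) (hN : 1 ≤ N) (z : EuclideanSpace ℝ (Fin N)) (hz : z ≠ 0) :
    LinearMap.det
        ((fderiv ℝ expZero z : EuclideanSpace ℝ (Fin N) →L[ℝ] EuclideanSpace ℝ (Fin N)) :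
          EuclideanSpace ℝ (Fin N) →ₗ[ℝ] EuclideanSpace ℝ (Fin N)) =
      (Real.sinh (2 * ‖z‖) / (‖z‖ * (1 + Real.cosh (2 * ‖z‖)))) ^ (N - 1) *
        (2 / (1 + Real.cosh (2 * ‖z‖))) ∧
    0 < LinearMap.det
        ((fderiv ℝ expZero z : EuclideanSpace ℝ (Fin N) →L[ℝ] EuclideanSpace ℝ (Fin N)) :
          EuclideanSpace ℝ (Fin N) →ₗ[ℝ] EuclideanSpace ℝ (Fin N)) := by
  have hr : 0 < ‖z‖ := norm_pos_iff.mpr hz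
  have hs : 0 < Real.sinh (2 * ‖z‖) := Real.sinh_pos_iff.mpr (by positivity)
  have h := det_fderiv_radial hz (hasDerivAt_sinh_div_one_add_cosh_mul hr.ne') (by positivity)
  have hdet : LinearMap.det
      ((fderiv ℝ expZero z : EuclideanSpace ℝ (Fin N) →L[ℝ] EuclideanSpace ℝ (Fin N)) :
        EuclideanSpace ℝ (Fin N) →ₗ[ℝ] EuclideanSpace ℝ (Fin N)) =
      (Real.sinh (2 * ‖z‖) / (‖z‖ * (1 + Real.cosh (2 * ‖z‖)))) ^ (N - 1) *
        (2 / (1 + Real.cosh (2 * ‖z‖))) := by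
    rw [finrank_euclideanSpace_fin, mul_div_cancel₀ _ hr.ne', add_sub_cancel,
      mul_comm (1 + _) ‖z‖] at h
    exact h
  refine ⟨hdet, ?_⟩
  rw [hdet]
  positivity
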